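/- arXiv:1905.02372 — 5 statements merged into one kernel-verified Lean document; each statement's English description precedes it below -/
import Mathlib

section
/- In the Compton kinematics, set v := ω₁/(m + ω₁) and γ := 1/sqrt(1 − v²), and let Λ be the 4×4 boost matrix with entries Λ₀₀ = Λ₃₃ = γ, Λ₀₃ = Λ₃₀ = −vγ, Λ₁₁ = Λ₂₂ = 1 and all other entries zero. Then 0 < v < 1, ω₁(1 − v) = m v, ω₂(1 − v cos θ) = m v, and the time components satisfy (Λ k₁)⁰ = (Λ k₂)⁰ = m v γ and (Λ q₁)⁰ = (Λ q₂)⁰ = m γ. -/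
noncomputable section

/-- The Minkowski inner product on ℝ⁴ with signature (+,−,−,−). -/
def minkowski (x y : Fin 4 → ℝ) : ℝ :=
  x 0 * y 0 - x 1 * y 1 - x 2 * y 2 - x 3 * y 3

/-- Incoming photon 4-momentum `k₁ = (ω₁, 0, 0, ω₁)`. -/
def kOne (ω₁ : ℝ) : Fin 4 → ℝ := ![ω₁, 0, 0, ω₁]

/-- Incoming electron 4-momentum `q₁ = (m, 0, 0, 0)` (electron at rest). -/
def qOne (m : ℝ) : Fin 4 → ℝ := ![m, 0, 0, 0]

/-- Outgoing photon energy `ω₂ = m ω₁ / (m + ω₁ (1 − cos θ))` (Compton formula). -/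
def omegaTwo (m ω₁ θ : ℝ) : ℝ := m * ω₁ / (m + ω₁ * (1 - Real.cos θ))

/-- Outgoing photon 4-momentum `k₂ = (ω₂, 0, ω₂ sin θ, ω₂ cos θ)`. -/
def kTwo (m ω₁ θ : ℝ) : Fin 4 → ℝ :=
  ![omegaTwo m ω₁ θ, 0, omegaTwo m ω₁ θ * Real.sin θ, omegaTwo m ω₁ θ * Real.cos θ]

/-- Outgoing electron 4-momentum `q₂ = q₁ + k₁ − k₂` (momentum conservation). -/
def qTwo (m ω₁ θ : ℝ) : Fin 4 → ℝ := qOne m + kOne ω₁ - kTwo m ω₁ θ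

/-- Boost from the laboratory frame to the center-of-momentum frame in Compton
scattering: with `v = ω₁/(m+ω₁)` and `γ = 1/√(1−v²)`, one has `0 < v < 1`,
`ω₁(1−v) = mv`, `ω₂(1−v cos θ) = mv`, and the boosted time components satisfy
`(Λk₁)⁰ = (Λk₂)⁰ = mvγ` and `(Λq₁)⁰ = (Λq₂)⁰ = mγ`. -/
theorem stmt6 (m ω₁ θ : ℝ) (hm : 0 < m) (hω : 0 < ω₁) :
    let v : ℝ := ω₁ / (m + ω₁)
    let γ : ℝ := 1 / Real.sqrt (1 - v ^ 2)
    let Λ : Matrix (Fin 4) (Fin 4) ℝ :=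
      Matrix.of ![![γ, 0, 0, -v * γ], ![0, 1, 0, 0], ![0, 0, 1, 0], ![-v * γ, 0, 0, γ]]
    0 < v ∧ v < 1 ∧
    ω₁ * (1 - v) = m * v ∧
    omegaTwo m ω₁ θ * (1 - v * Real.cos θ) = m * v ∧
    (Λ.mulVec (kOne ω₁)) 0 = m * v * γ ∧
    (Λ.mulVec (kTwo m ω₁ θ)) 0 = m * v * γ ∧
    (Λ.mulVec (qOne m)) 0 = m * γ ∧
    (Λ.mulVec (qTwo m ω₁ θ)) 0 = m * γ := by
  intro v γ Λ
  have hs : 0 < m + ω₁ := by positivity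
  have hd : m + ω₁ * (1 - Real.cos θ) ≠ 0 :=
    (add_pos_of_pos_of_nonneg hm
      (mul_nonneg hω.le (sub_nonneg.mpr (Real.cos_le_one θ)))).ne'
  have hv : v * (m + ω₁) = ω₁ := div_mul_cancel₀ _ hs.ne'
  have h₁ : ω₁ * (1 - v) = m * v := by linear_combination -hv
  have h₂ : omegaTwo m ω₁ θ * (1 - v * Real.cos θ) = m * v := by
    rw [omegaTwo, div_mul_eq_mul_div, div_eq_iff hd]
    linear_combination -m * hv
  have time_component (x : Fin 4 → ℝ) : (Λ.mulVec x) 0 = γ * (x 0 - v * x 3) := by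
    simp [Λ, Matrix.mulVec, dotProduct, Fin.sum_univ_four]
    ring
  have hk₁ : (Λ.mulVec (kOne ω₁)) 0 = m * v * γ := by
    rw [time_component]
    simp only [kOne, Matrix.cons_val]
    linear_combination γ * h₁
  have hk₂ : (Λ.mulVec (kTwo m ω₁ θ)) 0 = m * v * γ := by
    rw [time_component]
    simp only [kTwo, Matrix.cons_val]
    linear_combination γ * h₂
  have hq₁ : (Λ.mulVec (qOne m)) 0 = m * γ := by
    rw [time_component]
    simp only [qOne, Matrix.cons_val]
    ring
  refine ⟨div_pos hω hs, (div_lt_one hs).mpr (lt_add_of_pos_left _ hm), h₁, h₂, hk₁, hk₂, hq₁, ?_⟩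
  rw [qTwo, Matrix.mulVec_sub, Matrix.mulVec_add, Pi.sub_apply, Pi.add_apply, hq₁, hk₁, hk₂]
  ring
end
end

section
/- In the Compton kinematics, assume additionally cos θ ∈ [−1, 1], and define F(κ) := ω₁ + m − κ − sqrt(m² + ω₁² + κ² − 2 ω₁ κ cos θ) for κ ≥ 0. Then F is strictly decreasing on [0, ∞), F(ω₂) = 0 (so ω₂ is the unique zero of F), and the derivative at that zero equals F'(ω₂) = − m ω₁ / (ω₂ E₂'), where E₂' := m + ω₁ − ω₂. -/
noncomputable section

/-- The energy-conservation function
`F(κ) = ω₁ + m − κ − √(m² + ω₁² + κ² − 2ω₁κ cos θ)` is strictly decreasing on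
`[0,∞)`, vanishes exactly at `κ = ω₂`, and its derivative there equals
`−mω₁/(ω₂ E₂')` with `E₂' = m + ω₁ − ω₂`. -/
theorem stmt8 (m ω₁ θ : ℝ) (hm : 0 < m) (hω : 0 < ω₁)
    (hcos : Real.cos θ ∈ Set.Icc (-1 : ℝ) 1) :
    let F : ℝ → ℝ := fun κ =>
      ω₁ + m - κ - Real.sqrt (m ^ 2 + ω₁ ^ 2 + κ ^ 2 - 2 * ω₁ * κ * Real.cos θ)
    StrictAntiOn F (Set.Ici 0) ∧
    F (omegaTwo m ω₁ θ) = 0 ∧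
    (∀ κ ∈ Set.Ici (0 : ℝ), F κ = 0 → κ = omegaTwo m ω₁ θ) ∧
    HasDerivAt F
      (-(m * ω₁) / (omegaTwo m ω₁ θ * (m + ω₁ - omegaTwo m ω₁ θ)))
      (omegaTwo m ω₁ θ) := by
  obtain ⟨-, hc⟩ := hcos
  have hc2 := Real.sin_sq_add_cos_sq θ
  intro F
  generalize hw : omegaTwo m ω₁ θ = w
  have hD : 0 < m + ω₁ * (1 - Real.cos θ) := by
    have := mul_nonneg hω.le (sub_nonneg.2 hc)
    linarith
  have hwD : w * (m + ω₁ * (1 - Real.cos θ)) = m * ω₁ := by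
    rw [← hw, omegaTwo]
    exact div_mul_cancel₀ _ hD.ne'
  have hwpos : 0 < w := by
    rw [← hw, omegaTwo]
    positivity
  have hE : 0 < m + ω₁ - w := by
    have h : w * m ≤ ω₁ * m := by
      have := mul_nonneg hwpos.le (mul_nonneg hω.le (sub_nonneg.2 hc))
      linarith
    have := le_of_mul_le_mul_right h hm
    linarith
  have hsqrt : Real.sqrt (m ^ 2 + ω₁ ^ 2 + w ^ 2 - 2 * ω₁ * w * Real.cos θ) =
      m + ω₁ - w := by
    rw [show m ^ 2 + ω₁ ^ 2 + w ^ 2 - 2 * ω₁ * w * Real.cos θ = (m + ω₁ - w) ^ 2 by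
      linear_combination 2 * hwD]
    exact Real.sqrt_sq hE.le
  have hzero : F w = 0 := by
    simp only [F, hsqrt]
    ring
  have hanti : StrictAntiOn F (Set.Ici 0) := by
    intro a _ b _ hab
    have hR : (ω₁ * Real.cos θ - b) ^ 2 <
        m ^ 2 + ω₁ ^ 2 + b ^ 2 - 2 * ω₁ * b * Real.cos θ := by
      have h : m ^ 2 + ω₁ ^ 2 + b ^ 2 - 2 * ω₁ * b * Real.cos θ =
          (ω₁ * Real.cos θ - b) ^ 2 + (m ^ 2 + (ω₁ * Real.sin θ) ^ 2) := by
        linear_combination -ω₁ ^ 2 * hc2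
      rw [h]
      exact lt_add_of_pos_right _ (by positivity)
    have hs := Real.lt_sqrt_of_sq_lt hR
    have hsq := Real.sq_sqrt ((sq_nonneg _).trans hR.le)
    have hnn := Real.sqrt_nonneg (m ^ 2 + ω₁ ^ 2 + b ^ 2 - 2 * ω₁ * b * Real.cos θ)
    simp only [F]
    set s := Real.sqrt (m ^ 2 + ω₁ ^ 2 + b ^ 2 - 2 * ω₁ * b * Real.cos θ)
    have h : Real.sqrt (m ^ 2 + ω₁ ^ 2 + a ^ 2 - 2 * ω₁ * a * Real.cos θ) < b - a + s := by
      rw [Real.sqrt_lt' (by linarith)]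
      have := mul_pos (sub_pos.2 hab) (sub_pos.2 hs)
      linarith
    linarith
  refine ⟨hanti, hzero, fun κ hκ h => ?_, ?_⟩
  · exact hanti.injOn hκ hwpos.le (h.trans hzero.symm)
  · have hR : HasDerivAt
        (fun κ : ℝ => m ^ 2 + ω₁ ^ 2 + κ ^ 2 - 2 * ω₁ * κ * Real.cos θ)
        (2 * w - 2 * ω₁ * Real.cos θ) w := by
      have h := (((hasDerivAt_id w).pow 2).const_add (m ^ 2 + ω₁ ^ 2)).sub
        (((hasDerivAt_id w).const_mul (2 * ω₁)).mul_const (Real.cos θ))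
      exact h.congr_deriv (by simp)
    have hne : m ^ 2 + ω₁ ^ 2 + w ^ 2 - 2 * ω₁ * w * Real.cos θ ≠ 0 := by
      intro h
      rw [h, Real.sqrt_zero] at hsqrt
      linarith
    have h := ((hasDerivAt_id w).const_sub (ω₁ + m)).sub (hR.sqrt hne)
    refine h.congr_deriv ?_
    rw [hsqrt]
    have := hE.ne'
    field_simp
    linear_combination -hwD
end
end

section
/- For every ω > 0 and every t ∈ ℝ, the limit as ε → 0⁺ of (iω/π) · ∫_{−∞}^{∞} exp(−i s t) / ( s² − (ω − iε)² ) ds equals exp(−i ω |t|). In particular, for each ε > 0 the integrand is absolutely integrable over ℝ. -/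
open MeasureTheory

section TwoSidedExponential

open Complex FourierTransform

lemma add_I_mul_ne_zero {a : ℂ} (ha : 0 < a.re) (s : ℝ) : a + I * s ≠ 0 := by
  intro h
  have := congrArg re h
  simp at this
  linarith

lemma sq_add_sq_eq_mul (a : ℂ) (s : ℝ) :
    (s : ℂ) ^ 2 + a ^ 2 = (a + I * s) * (a + I * (-s : ℝ)) := by
  push_cast
  linear_combination ((s : ℂ) ^ 2) * I_sq

lemma sq_add_sq_ne_zero {a : ℂ} (ha : 0 < a.re) (s : ℝ) : (s : ℂ) ^ 2 + a ^ 2 ≠ 0 := by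
  rw [sq_add_sq_eq_mul]
  exact mul_ne_zero (add_I_mul_ne_zero ha s) (add_I_mul_ne_zero ha (-s))

lemma integrable_inv_sq_add_add_sq {r : ℝ} (hr : 0 < r) (m : ℝ) :
    Integrable fun s : ℝ ↦ (r ^ 2 + (s + m) ^ 2)⁻¹ := by
  have h := ((integrable_inv_one_add_sq.comp_div hr.ne').comp_add_right m).const_mul (r ^ 2)⁻¹
  refine h.congr (.of_forall fun s ↦ ?_)
  simp only
  rw [← mul_inv]
  congr 1
  field_simp

lemma integrable_inv_sq_add_sq {a : ℂ} (ha : 0 < a.re) :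
    Integrable fun s : ℝ ↦ ((s : ℂ) ^ 2 + a ^ 2)⁻¹ := by
  refine ((integrable_inv_sq_add_add_sq ha a.im).add
    (integrable_inv_sq_add_add_sq ha (-a.im))).mono' ?_ (.of_forall fun s ↦ ?_)
  · exact (Continuous.inv₀ (by fun_prop) (sq_add_sq_ne_zero ha)).aestronglyMeasurable
  · have h₁ : ‖a + I * s‖ ^ 2 = a.re ^ 2 + (s + a.im) ^ 2 := by
      rw [← normSq_eq_norm_sq, normSq_apply]
      simp
      ring
    have h₂ : ‖a + I * (-s : ℝ)‖ ^ 2 = a.re ^ 2 + (s + -a.im) ^ 2 := by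
      rw [← normSq_eq_norm_sq, normSq_apply]
      simp
      ring
    rw [sq_add_sq_eq_mul, norm_inv, norm_mul, Pi.add_apply, ← h₁, ← h₂, mul_inv, ← inv_pow, ← inv_pow]
    nlinarith [sq_nonneg (‖a + I * s‖⁻¹ - ‖a + I * (-s : ℝ)‖⁻¹),
      sq_nonneg ‖a + I * s‖⁻¹, sq_nonneg ‖a + I * (-s : ℝ)‖⁻¹]

lemma integrable_exp_div_sq_add_sq {a : ℂ} (ha : 0 < a.re) (t : ℝ) :
    Integrable fun s : ℝ ↦ exp (-I * s * t) / ((s : ℂ) ^ 2 + a ^ 2) := by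
  refine (integrable_inv_sq_add_sq ha).mono ?_ (.of_forall fun s ↦ ?_)
  · exact (Continuous.div (by fun_prop) (by fun_prop)
      (sq_add_sq_ne_zero ha)).aestronglyMeasurable
  · simp [norm_exp]

lemma exp_mul_exp_neg_mul_abs_of_nonpos (a b : ℂ) {x : ℝ} (hx : x ≤ 0) :
    exp (b * x) * exp (-a * |x|) = exp ((a + b) * x) := by
  rw [← exp_add, abs_of_nonpos hx]
  congr 1
  push_cast
  ring

lemma exp_mul_exp_neg_mul_abs_of_nonneg (a b : ℂ) {x : ℝ} (hx : 0 ≤ x) :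
    exp (b * x) * exp (-a * |x|) = exp ((-a + b) * x) := by
  rw [← exp_add, abs_of_nonneg hx]
  congr 1
  ring

lemma integrableOn_exp_mul_exp_neg_mul_abs_Iic {a b : ℂ} (h : 0 < (a + b).re) :
    IntegrableOn (fun x : ℝ ↦ exp (b * x) * exp (-a * |x|)) (Set.Iic 0) :=
  (integrableOn_exp_mul_complex_Iic h 0).congr_fun
    (fun _ hx ↦ (exp_mul_exp_neg_mul_abs_of_nonpos a b hx).symm) measurableSet_Iic

lemma integrableOn_exp_mul_exp_neg_mul_abs_Ioi {a b : ℂ} (h : (-a + b).re < 0) :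
    IntegrableOn (fun x : ℝ ↦ exp (b * x) * exp (-a * |x|)) (Set.Ioi 0) :=
  (integrableOn_exp_mul_complex_Ioi h 0).congr_fun
    (fun _ hx ↦ (exp_mul_exp_neg_mul_abs_of_nonneg a b (le_of_lt hx)).symm) measurableSet_Ioi

lemma integrable_exp_neg_mul_abs {a : ℂ} (ha : 0 < a.re) :
    Integrable fun x : ℝ ↦ exp (-a * |x|) := by
  have h := (integrableOn_exp_mul_exp_neg_mul_abs_Iic (a := a) (b := 0) (by simpa)).union
    (integrableOn_exp_mul_exp_neg_mul_abs_Ioi (a := a) (b := 0) (by simpa))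
  rw [Set.Iic_union_Ioi, integrableOn_univ] at h
  simpa using h

lemma integral_exp_mul_exp_neg_mul_abs {a b : ℂ} (h₁ : 0 < (a + b).re) (h₂ : (-a + b).re < 0) :
    ∫ x : ℝ, exp (b * x) * exp (-a * |x|) = 1 / (a + b) - 1 / (-a + b) := by
  rw [← intervalIntegral.integral_Iic_add_Ioi (integrableOn_exp_mul_exp_neg_mul_abs_Iic h₁)
      (integrableOn_exp_mul_exp_neg_mul_abs_Ioi h₂),
    setIntegral_congr_fun measurableSet_Iic
      (fun _ hx ↦ exp_mul_exp_neg_mul_abs_of_nonpos a b hx),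
    setIntegral_congr_fun measurableSet_Ioi
      (fun _ hx ↦ exp_mul_exp_neg_mul_abs_of_nonneg a b (le_of_lt hx)),
    integral_exp_mul_complex_Iic h₁, integral_exp_mul_complex_Ioi h₂]
  simp
  ring

lemma fourier_exp_neg_mul_abs {a : ℂ} (ha : 0 < a.re) (w : ℝ) :
    𝓕 (fun x : ℝ ↦ exp (-a * |x|)) w =
      2 * a * (((2 * Real.pi * w : ℝ) : ℂ) ^ 2 + a ^ 2)⁻¹ := by
  rw [Real.fourier_real_eq_integral_exp_smul]
  have h := integral_exp_mul_exp_neg_mul_abs (a := a) (b := I * (-(2 * Real.pi * w) : ℝ))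
    (by simpa) (by simpa)
  have hn := add_I_mul_ne_zero ha (-(2 * Real.pi * w))
  have hp := add_I_mul_ne_zero ha (2 * Real.pi * w)
  have hs := sq_add_sq_ne_zero ha (2 * Real.pi * w)
  have hp' : -a + I * (-(2 * Real.pi * w) : ℝ) ≠ 0 := by
    intro h0
    apply hp
    push_cast at h0 ⊢
    linear_combination -h0
  calc _ = ∫ x : ℝ, exp (I * (-(2 * Real.pi * w) : ℝ) * x) * exp (-a * |x|) := by
        congr 1 with x
        rw [smul_eq_mul]
        congr 2
        push_cast
        ring
    _ = _ := by
        rw [h, div_sub_div _ _ hn hp', ← div_eq_mul_inv, div_eq_div_iff (mul_ne_zero hn hp') hs]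
        push_cast
        linear_combination (2 * a * (2 * Real.pi * w) ^ 2) * -I_sq

lemma integral_exp_div_sq_add_sq {a : ℂ} (ha : 0 < a.re) (t : ℝ) :
    ∫ s : ℝ, exp (-I * s * t) / ((s : ℂ) ^ 2 + a ^ 2) = Real.pi / a * exp (-a * |t|) := by
  have hπ : (0 : ℝ) < 2 * Real.pi := by positivity
  have ha0 : a ≠ 0 := by
    rintro rfl
    simp at ha
  have hF := funext (fourier_exp_neg_mul_abs ha)
  have hint : Integrable (𝓕 fun x : ℝ ↦ exp (-a * |x|)) := by
    rw [hF]
    exact ((integrable_inv_sq_add_sq ha).comp_mul_left' hπ.ne').const_mul (2 * a)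
  have hinv := (integrable_exp_neg_mul_abs ha).fourierInv_fourier_eq hint (v := -t)
    (by fun_prop)
  rw [hF, Real.fourierInv_eq'] at hinv
  have hscale := Measure.integral_comp_mul_left
    (fun s : ℝ ↦ exp (-I * s * t) / ((s : ℂ) ^ 2 + a ^ 2)) (2 * Real.pi)
  have hint_eq : ∫ w : ℝ, exp ((2 * Real.pi * inner ℝ w (-t) : ℝ) * I) •
        (2 * a * (((2 * Real.pi * w : ℝ) : ℂ) ^ 2 + a ^ 2)⁻¹) =
      2 * a * ∫ w : ℝ, exp (-I * (2 * Real.pi * w : ℝ) * t) /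
        (((2 * Real.pi * w : ℝ) : ℂ) ^ 2 + a ^ 2) := by
    rw [← integral_const_mul]
    congr 1 with w
    rw [smul_eq_mul, div_eq_mul_inv, mul_left_comm]
    congr 3
    simp
    ring
  rw [hint_eq, hscale, abs_of_pos (inv_pos.mpr hπ), real_smul, abs_neg] at hinv
  rw [← hinv]
  have : (Real.pi : ℂ) ≠ 0 := by exact_mod_cast Real.pi_ne_zero
  generalize ∫ s : ℝ, exp (-I * s * t) / ((s : ℂ) ^ 2 + a ^ 2) = J
  push_cast
  field_simp

end TwoSidedExponential

/-- Contour-integral representation of `exp(−iω|t|)`: for `ω > 0` and `t ∈ ℝ`,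
for each `ε > 0` the function `s ↦ exp(−ist)/(s² − (ω − iε)²)` is integrable
on ℝ, and `(iω/π) ∫ exp(−ist)/(s² − (ω − iε)²) ds → exp(−iω|t|)` as `ε → 0⁺`. -/
theorem stmt9 (ω t : ℝ) (hω : 0 < ω) :
    (∀ ε : ℝ, 0 < ε →
      Integrable (fun s : ℝ =>
        Complex.exp (-Complex.I * (s : ℂ) * (t : ℂ)) /
          ((s : ℂ) ^ 2 - ((ω : ℂ) - Complex.I * (ε : ℂ)) ^ 2))) ∧
    Filter.Tendsto
      (fun ε : ℝ =>
        (Complex.I * (ω : ℂ) / (Real.pi : ℂ)) *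
          ∫ s : ℝ, Complex.exp (-Complex.I * (s : ℂ) * (t : ℂ)) /
            ((s : ℂ) ^ 2 - ((ω : ℂ) - Complex.I * (ε : ℂ)) ^ 2))
      (nhdsWithin 0 (Set.Ioi 0))
      (nhds (Complex.exp (-Complex.I * (ω : ℂ) * (|t| : ℝ)))) := by
  have hre (ε : ℝ) (hε : 0 < ε) : 0 < ((ε : ℂ) + Complex.I * ω).re := by simpa
  have hden (s ε : ℝ) : (s : ℂ) ^ 2 - ((ω : ℂ) - Complex.I * (ε : ℂ)) ^ 2 =
      (s : ℂ) ^ 2 + ((ε : ℂ) + Complex.I * ω) ^ 2 := by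
    linear_combination (-(ε : ℂ) ^ 2 - (ω : ℂ) ^ 2) * Complex.I_sq
  simp_rw [hden]
  refine ⟨fun ε hε ↦ integrable_exp_div_sq_add_sq (hre ε hε) t, ?_⟩
  have hω' : (ω : ℂ) ≠ 0 := by exact_mod_cast hω.ne'
  have hπ : (Real.pi : ℂ) ≠ 0 := by exact_mod_cast Real.pi_ne_zero
  have hlim : ContinuousAt (fun ε : ℝ ↦ Complex.I * (ω : ℂ) / ((ε : ℂ) + Complex.I * ω) *
      Complex.exp (-((ε : ℂ) + Complex.I * ω) * (|t| : ℝ))) 0 := by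
    refine ContinuousAt.mul (ContinuousAt.div (by fun_prop) (by fun_prop) ?_) (by fun_prop)
    simpa using hω.ne'
  have h := hlim.tendsto.mono_left (nhdsWithin_le_nhds (s := Set.Ioi 0))
  simp only [Complex.ofReal_zero, zero_add, div_self (mul_ne_zero Complex.I_ne_zero hω')] at h
  rw [one_mul, ← neg_mul] at h
  refine h.congr' ?_
  filter_upwards [self_mem_nhdsWithin] with ε hε
  rw [integral_exp_div_sq_add_sq (hre ε hε)]
  field_simp
end

section
/- For every τ > 0, the function κ ↦ κ³ · ( 2 / ( exp(κ/τ + τ/κ) − 1 ) )^{1/2} is integrable on (0, ∞), and ∫₀^∞ κ³ ( 2/(exp(κ/τ + τ/κ) − 1) )^{1/2} dκ = τ⁴ · ∫₀^∞ x³ ( 2/(exp(x + 1/x) − 1) )^{1/2} dx, where the latter integral is a finite constant (numerically ≈ 12.7217). -/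
open MeasureTheory

/-- The integrand in units of `τ`, dominated by `2 x³ exp (-x / 2)`, is integrable. -/
theorem integrableOn_unit_integrand :
    IntegrableOn
      (fun x : ℝ => x ^ 3 * (2 / (Real.exp (x + 1 / x) - 1)) ^ ((1 : ℝ) / 2))
      (Set.Ioi 0) := by
  have hdom : IntegrableOn (fun x : ℝ => 2 * (x ^ (3 : ℝ) * Real.exp (-(1 / 2) * x)))
      (Set.Ioi 0) :=
    (integrableOn_rpow_mul_exp_neg_mul_rpow (s := 3) (p := 1) (by norm_num) one_pos
      (b := 1 / 2) (by norm_num)).congr_fun (fun x _ => by simp) measurableSet_Ioi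
      |>.const_mul 2
  refine Integrable.mono' hdom (by fun_prop) ?_
  filter_upwards [ae_restrict_mem measurableSet_Ioi] with x hx
  have hx : 0 < x := hx
  have hinv : 0 < 1 / x := by positivity
  have htwo : 2 ≤ x + 1 / x := by
    have h : x + 1 / x - 2 = (x - 1) ^ 2 / x := by field_simp; ring
    have : 0 ≤ (x - 1) ^ 2 / x := by positivity
    linarith
  have hexp := Real.add_one_le_exp (x + 1 / x)
  have hmono : Real.exp x ≤ Real.exp (x + 1 / x) := Real.exp_le_exp.2 (by linarith)
  have hbound : 2 / (Real.exp (x + 1 / x) - 1) ≤ (2 * Real.exp (-(1 / 2) * x)) ^ 2 := by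
    have hsq : (2 * Real.exp (-(1 / 2) * x)) ^ 2 = 4 / Real.exp x := by
      rw [mul_pow, ← Real.exp_nat_mul, div_eq_mul_inv 4, ← Real.exp_neg]
      congr 1
      · norm_num
      · congr 1
        push_cast
        ring
    rw [hsq, div_le_div_iff₀ (by linarith) (Real.exp_pos x)]
    linarith
  have hnonneg : 0 ≤ 2 / (Real.exp (x + 1 / x) - 1) := div_nonneg zero_le_two (by linarith)
  rw [Real.norm_of_nonneg (mul_nonneg (by positivity) (Real.rpow_nonneg hnonneg _)),
    ← Real.sqrt_eq_rpow, show x ^ (3 : ℝ) = x ^ 3 from by exact_mod_cast Real.rpow_natCast x 3,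
    mul_left_comm]
  exact mul_le_mul_of_nonneg_left (Real.sqrt_le_iff.2 ⟨by positivity, hbound⟩) (by positivity)

/-- The zero-point energy density integrand of the free Maxwell field is
integrable on `(0,∞)` and scales as `τ⁴`:
`∫₀^∞ κ³ (2/(exp(κ/τ + τ/κ) − 1))^{1/2} dκ
  = τ⁴ ∫₀^∞ x³ (2/(exp(x + 1/x) − 1))^{1/2} dx`, the latter being finite. -/
theorem stmt12 (τ : ℝ) (hτ : 0 < τ) :
    IntegrableOn
      (fun κ : ℝ => κ ^ 3 * (2 / (Real.exp (κ / τ + τ / κ) - 1)) ^ ((1 : ℝ) / 2))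
      (Set.Ioi 0) ∧
    IntegrableOn
      (fun x : ℝ => x ^ 3 * (2 / (Real.exp (x + 1 / x) - 1)) ^ ((1 : ℝ) / 2))
      (Set.Ioi 0) ∧
    (∫ κ in Set.Ioi (0 : ℝ), κ ^ 3 * (2 / (Real.exp (κ / τ + τ / κ) - 1)) ^ ((1 : ℝ) / 2))
      = τ ^ 4 *
        ∫ x in Set.Ioi (0 : ℝ), x ^ 3 * (2 / (Real.exp (x + 1 / x) - 1)) ^ ((1 : ℝ) / 2) := by
  have hscale : (fun κ : ℝ => κ ^ 3 * (2 / (Real.exp (κ / τ + τ / κ) - 1)) ^ ((1 : ℝ) / 2)) =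
      fun κ => τ ^ 3 * (fun x : ℝ =>
        x ^ 3 * (2 / (Real.exp (x + 1 / x) - 1)) ^ ((1 : ℝ) / 2)) (τ⁻¹ * κ) := by
    funext κ
    have h₁ : τ⁻¹ * κ = κ / τ := by ring
    have h₂ : κ ^ 3 = τ ^ 3 * (κ / τ) ^ 3 := by field_simp
    simp only [h₁, one_div_div]
    rw [h₂, mul_assoc]
  refine ⟨?_, integrableOn_unit_integrand, ?_⟩
  · rw [hscale]
    refine Integrable.const_mul ?_ _
    exact (integrableOn_Ioi_comp_mul_left_iff _ 0 (inv_pos.2 hτ)).2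
      (by simpa only [mul_zero] using integrableOn_unit_integrand)
  · rw [hscale, integral_const_mul, integral_comp_mul_left_Ioi
      (fun x : ℝ => x ^ 3 * (2 / (Real.exp (x + 1 / x) - 1)) ^ ((1 : ℝ) / 2)) 0 (inv_pos.2 hτ),
      mul_zero, inv_inv, smul_eq_mul]
    ring
end

section
/- The function κ ↦ ( 2 / (exp(κ + 1/κ) − 1) )^{1/2} is integrable on (0, ∞): ∫₀^∞ ( 2/(exp(κ + 1/κ) − 1) )^{1/2} dκ < ∞. -/
open MeasureTheory

/-- The square root of the photon Gibbs weight is dominated by an exponential. -/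
lemma rpow_half_two_div_exp_add_inv_sub_one_le {κ : ℝ} (hκ : 0 < κ) :
    (2 / (Real.exp (κ + 1 / κ) - 1)) ^ ((1 : ℝ) / 2) ≤ 2 * Real.exp (-(1 / 2) * κ) := by
  have hinv : 0 < 1 / κ := by positivity
  have hle : Real.exp κ ≤ Real.exp (κ + 1 / κ) := Real.exp_le_exp.2 (by linarith)
  have htwo : 2 ≤ κ + 1 / κ := by
    have h : κ + 1 / κ - 2 = (κ - 1) ^ 2 / κ := by field_simp; ring
    have : 0 ≤ (κ - 1) ^ 2 / κ := by positivity
    linarith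
  have hexp : 2 ≤ Real.exp (κ + 1 / κ) := by
    linarith [Real.add_one_le_exp (κ + 1 / κ)]
  rw [← Real.sqrt_eq_rpow]
  refine Real.sqrt_le_iff.2 ⟨by positivity, ?_⟩
  have hsq : (2 * Real.exp (-(1 / 2) * κ)) ^ 2 = 4 / Real.exp κ := by
    rw [mul_pow, ← Real.exp_nat_mul, div_eq_mul_inv 4, ← Real.exp_neg]
    push_cast
    ring_nf
  rw [hsq, div_le_div_iff₀ (by linarith) (Real.exp_pos κ)]
  linarith

/-- Finiteness of the electromagnetic mass correction: the squared photon Gibbs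
factor `κ ↦ (2/(exp(κ + 1/κ) − 1))^{1/2}` is integrable on `(0,∞)`. -/
theorem stmt18 :
    IntegrableOn
      (fun κ : ℝ => (2 / (Real.exp (κ + 1 / κ) - 1)) ^ ((1 : ℝ) / 2))
      (Set.Ioi 0) := by
  refine ((exp_neg_integrableOn_Ioi 0 (by norm_num : (0 : ℝ) < 1 / 2)).const_mul 2).mono' ?_ ?_
  · exact Measurable.aestronglyMeasurable (by fun_prop)
  · filter_upwards [ae_restrict_mem measurableSet_Ioi] with κ hκ
    have hκ : 0 < κ := hκ
    have h : 1 ≤ Real.exp (κ + 1 / κ) := Real.one_le_exp (by positivity)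
    rw [Real.norm_of_nonneg
      (Real.rpow_nonneg (div_nonneg zero_le_two (sub_nonneg.2 h)) _)]
    exact rpow_half_two_div_exp_add_inv_sub_one_le hκ
end
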